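/- Let (Ω,T) be a minimal subshift over a finite alphabet 𝒜 ⊂ ℝ that satisfies Boshernitzan's condition (B), with unique T-invariant Borel probability measure μ. For E ∈ ℝ define the locally constant map M^E : Ω → SL(2,ℝ) by M^E(ω) = [[E − ω(1), −1],[1, 0]], and define the Lyapunov exponent γ(E) := inf_{n≥1} (1/n) ∫_Ω log‖M^E(n,ω)‖ dμ(ω). Then γ : ℝ → [0,∞) is continuous. -/

import Mathlib

open Filter MeasureTheory Set

noncomputable section

/-- `SL(2,ℝ)`. -/
abbrev SL2 : Type := Matrix.SpecialLinearGroup (Fin 2) ℝ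

/-- The left shift on two-sided sequences. -/
def shift (𝒜 : Type*) : (ℤ → 𝒜) → ℤ → 𝒜 := fun ω n => ω (n + 1)

/-- A subshift: a closed, shift-invariant set of two-sided sequences. -/
def IsSubshift {𝒜 : Type*} [TopologicalSpace 𝒜] (Ω : Set (ℤ → 𝒜)) : Prop :=
  IsClosed Ω ∧ shift 𝒜 '' Ω = Ω

/-- A minimal subshift: every two-sided orbit is dense. -/
def IsMinimalSubshift {𝒜 : Type*} [TopologicalSpace 𝒜] (Ω : Set (ℤ → 𝒜)) : Prop :=
  IsSubshift Ω ∧ ∀ ω ∈ Ω, Ω ⊆ closure (Set.range fun k : ℤ => fun n : ℤ => ω (n + k))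

/-- An aperiodic subshift: no nontrivial shift fixes a point of `Ω`. -/
def IsAperiodicSubshift {𝒜 : Type*} (Ω : Set (ℤ → 𝒜)) : Prop :=
  ∀ ω ∈ Ω, ∀ n : ℤ, n ≠ 0 → (fun m => ω (m + n)) ≠ ω

/-- The word `w` occurs in `ω` starting at position `k`. -/
def OccursAt {𝒜 : Type*} (ω : ℤ → 𝒜) (w : List 𝒜) (k : ℤ) : Prop :=
  ∀ i : Fin w.length, ω (k + i) = w.get i

/-- `w` belongs to `𝒲(Ω)`, the set of finite words of the subshift `Ω`. -/
def IsWordOf {𝒜 : Type*} (Ω : Set (ℤ → 𝒜)) (w : List 𝒜) : Prop :=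
  ∃ ω ∈ Ω, ∃ k : ℤ, OccursAt ω w k

/-- `V_w = {ω ∈ Ω : ω(1)⋯ω(|w|) = w}`. -/
def Vset {𝒜 : Type*} (Ω : Set (ℤ → 𝒜)) (w : List 𝒜) : Set (ℤ → 𝒜) :=
  {ω ∈ Ω | OccursAt ω w 1}

/-- `U_w = {ω ∈ Ω : w occurs in ω around position one}`. -/
def Uset {𝒜 : Type*} (Ω : Set (ℤ → 𝒜)) (w : List 𝒜) : Set (ℤ → 𝒜) :=
  {ω ∈ Ω | ∃ n : ℕ, n < w.length ∧ OccursAt ω w (1 - n)}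

/-- Boshernitzan's condition (B): there are an ergodic probability measure `ν` (concentrated
on `Ω`), a constant `C > 0` and lengths `l n → ∞` with `|w| ν(V_w) ≥ C` whenever `|w| = l n`;
equivalently `limsup n η_ν(n) > 0`. -/
def CondB {𝒜 : Type*} [MeasurableSpace 𝒜] (Ω : Set (ℤ → 𝒜)) : Prop :=
  ∃ ν : Measure (ℤ → 𝒜), IsProbabilityMeasure ν ∧ ν Ωᶜ = 0 ∧ Ergodic (shift 𝒜) ν ∧
    ∃ C > (0 : ℝ), ∃ l : ℕ → ℕ, Tendsto l atTop atTop ∧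
      ∀ n : ℕ, ∀ w : List 𝒜, IsWordOf Ω w → w.length = l n →
        C ≤ (w.length : ℝ) * (ν (Vset Ω w)).toReal

/-- Condition (B'): there are an ergodic probability measure `ν` (concentrated on `Ω`),
a constant `C' > 0` and lengths `l n → ∞` with `ν(U_w) ≥ C'` whenever `|w| = l n`. -/
def CondB' {𝒜 : Type*} [MeasurableSpace 𝒜] (Ω : Set (ℤ → 𝒜)) : Prop :=
  ∃ ν : Measure (ℤ → 𝒜), IsProbabilityMeasure ν ∧ ν Ωᶜ = 0 ∧ Ergodic (shift 𝒜) ν ∧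
    ∃ C > (0 : ℝ), ∃ l : ℕ → ℕ, Tendsto l atTop atTop ∧
      ∀ n : ℕ, ∀ w : List 𝒜, IsWordOf Ω w → w.length = l n →
        C ≤ (ν (Uset Ω w)).toReal

/-- Unique ergodicity: there is exactly one shift-invariant Borel probability measure
concentrated on `Ω`. -/
def UniquelyErgodicSubshift {𝒜 : Type*} [MeasurableSpace 𝒜] (Ω : Set (ℤ → 𝒜)) : Prop :=
  ∃! ν : Measure (ℤ → 𝒜),
    IsProbabilityMeasure ν ∧ ν Ωᶜ = 0 ∧ MeasurePreserving (shift 𝒜) ν ν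

/-- A function on sequences is locally constant (on `Ω`) if its value only depends on
the coordinates `ω(−N)⋯ω(N)` for some `N`. -/
def LocConstOn {𝒜 β : Type*} (Ω : Set (ℤ → 𝒜)) (A : (ℤ → 𝒜) → β) : Prop :=
  ∃ N : ℕ, ∀ ω ∈ Ω, ∀ ρ ∈ Ω, (∀ i : ℤ, |i| ≤ (N : ℤ) → ω i = ρ i) → A ω = A ρ

/-- The cocycle `A(n,ω) = A(T^{n−1}ω)⋯A(ω)`. -/
def cocycle {𝒜 G : Type*} [Monoid G] (A : (ℤ → 𝒜) → G) : ℕ → (ℤ → 𝒜) → G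
  | 0, _ => 1
  | n + 1, ω => A ((shift 𝒜)^[n] ω) * cocycle A n ω

/-- A concrete norm on 2×2 real matrices (the Frobenius norm). -/
def matNorm (M : Matrix (Fin 2) (Fin 2) ℝ) : ℝ :=
  Real.sqrt (∑ i : Fin 2, ∑ j : Fin 2, (M i j) ^ 2)

/-- `A : Ω → SL(2,ℝ)` is uniform: `(1/n) log‖A(n,ω)‖` converges, uniformly on `Ω`,
to a constant `Λ(A)`. -/
def IsUniformOn {𝒜 : Type*} (Ω : Set (ℤ → 𝒜)) (A : (ℤ → 𝒜) → SL2) : Prop :=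
  ∃ Λ : ℝ, TendstoUniformlyOn
    (fun (n : ℕ) (ω : ℤ → 𝒜) =>
      (n : ℝ)⁻¹ * Real.log (matNorm ((cocycle A n ω : SL2) : Matrix (Fin 2) (Fin 2) ℝ)))
    (fun _ => Λ) atTop Ω

/-- Property (P): every locally constant `SL(2,ℝ)`-valued function on `Ω` is uniform. -/
def PropP {𝒜 : Type*} (Ω : Set (ℤ → 𝒜)) : Prop :=
  ∀ A : (ℤ → 𝒜) → SL2, LocConstOn Ω A → IsUniformOn Ω A

/-- The word `ω(1)⋯ω(n)`. -/
def wordOf {𝒜 : Type*} (ω : ℤ → 𝒜) (n : ℕ) : List 𝒜 :=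
  (List.range n).map fun i => ω (1 + i)

/-- A subadditive function on the words of `Ω`. -/
def SubadditiveOn {𝒜 : Type*} (Ω : Set (ℤ → 𝒜)) (F : List 𝒜 → ℝ) : Prop :=
  ∀ x y : List 𝒜, IsWordOf Ω x → IsWordOf Ω y → IsWordOf Ω (x ++ y) →
    F (x ++ y) ≤ F x + F y

/-- The complexity function `p(n) = #{w ∈ 𝒲(Ω) : |w| = n}`. -/
def complexity {𝒜 : Type*} (Ω : Set (ℤ → 𝒜)) (n : ℕ) : ℕ :=
  Set.ncard {w : List 𝒜 | IsWordOf Ω w ∧ w.length = n}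

/-- A right-special word. -/
def RightSpecial {𝒜 : Type*} (Ω : Set (ℤ → 𝒜)) (w : List 𝒜) : Prop :=
  ∃ a b : 𝒜, a ≠ b ∧ IsWordOf Ω (w ++ [a]) ∧ IsWordOf Ω (w ++ [b])

/-- A left-special word. -/
def LeftSpecial {𝒜 : Type*} (Ω : Set (ℤ → 𝒜)) (w : List 𝒜) : Prop :=
  ∃ a b : 𝒜, a ≠ b ∧ IsWordOf Ω (a :: w) ∧ IsWordOf Ω (b :: w)

/-- `σ ∈ ℬ^ℤ` is the image of `ω ∈ 𝒜^ℤ` under the substitution `S`, with `S(ω(0))`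
starting at position `0`. -/
def IsSubstImage {𝒜 ℬ : Type*} (S : 𝒜 → List ℬ) (ω : ℤ → 𝒜) (σ : ℤ → ℬ) : Prop :=
  ∃ c : ℤ → ℤ, c 0 = 0 ∧ (∀ k : ℤ, c (k + 1) = c k + (S (ω k)).length) ∧
    ∀ k : ℤ, ∀ j : Fin (S (ω k)).length, σ (c k + j) = (S (ω k)).get j

/-- `Ω(S) = {T^k S(ω) : ω ∈ Ω, k ∈ ℤ}`. -/
def SubstSubshift {𝒜 ℬ : Type*} (S : 𝒜 → List ℬ) (Ω : Set (ℤ → 𝒜)) : Set (ℤ → ℬ) :=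
  {τ | ∃ ω ∈ Ω, ∃ σ : ℤ → ℬ, IsSubstImage S ω σ ∧ ∃ k : ℤ, τ = fun n => σ (n + k)}

/-- `S` is recognizable with respect to `(Ω,T)`: there is a locally constant
`S̃ : Ω(S) → Ω × ℤ` with `S̃(T^k S(ω)) = (ω,k)` for `0 ≤ k ≤ |S(ω(0))|`. -/
def Recognizable {𝒜 ℬ : Type*} (S : 𝒜 → List ℬ) (Ω : Set (ℤ → 𝒜)) : Prop :=
  ∃ St : (ℤ → ℬ) → (ℤ → 𝒜) × ℤ, LocConstOn (SubstSubshift S Ω) St ∧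
    ∀ ω ∈ Ω, ∀ σ : ℤ → ℬ, IsSubstImage S ω σ →
      ∀ k : ℕ, k ≤ (S (ω 0)).length → St (fun n => σ (n + k)) = (ω, (k : ℤ))

/-- A Cantor set: compact, empty interior, no isolated points. -/
def IsCantorSet (S : Set ℝ) : Prop :=
  IsCompact S ∧ interior S = ∅ ∧ ∀ x ∈ S, AccPt x (Filter.principal S)

/-- `H` is the Schrödinger operator on `ℓ²(ℤ)` with potential `V`:
`(Hu)(n) = u(n+1) + u(n−1) + V(n)u(n)`. -/
def IsSchrodingerOp (V : ℤ → ℝ)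
    (H : lp (fun _ : ℤ => ℝ) 2 →L[ℝ] lp (fun _ : ℤ => ℝ) 2) : Prop :=
  ∀ u : lp (fun _ : ℤ => ℝ) 2, ∀ n : ℤ,
    (H u : ∀ _ : ℤ, ℝ) n = (u : ∀ _ : ℤ, ℝ) (n + 1) + (u : ∀ _ : ℤ, ℝ) (n - 1)
      + V n * (u : ∀ _ : ℤ, ℝ) n

/-- The circle map potential `V_{α,β,θ}(n) = χ_{[1−β,1)}(nα + θ mod 1)`. -/
def circleV (α β θ : ℝ) : ℤ → ℝ := fun n =>
  (Set.Ico (1 - β) 1).indicator (fun _ => (1 : ℝ)) (Int.fract (n * α + θ))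

/-- The coding `v_n(α,β,θ) = χ_{[0,β)}(nα + θ mod 1)` of the rotation by `α`. -/
def circleSeq (α β θ : ℝ) : ℤ → Bool := fun n =>
  if Int.fract (n * α + θ) < β then true else false

/-- The circle map subshift `Ω_{α,β}`. -/
def circleSubshift (α β : ℝ) : Set (ℤ → Bool) :=
  closure {ω | ∃ θ : ℝ, 0 ≤ θ ∧ θ < 1 ∧ ω = circleSeq α β θ}

/-- The one-step transfer matrix `M^E(ω)`. -/
def transferMat (E : ℝ) (ω : ℤ → ℝ) : Matrix (Fin 2) (Fin 2) ℝ :=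
  !![E - ω 1, -1; 1, 0]

/-- The Lyapunov exponent `γ(E) = inf_{n ≥ 1} (1/n) ∫ log‖M^E(n,ω)‖ dμ(ω)`. -/
def lyapunov (μ : Measure (ℤ → ℝ)) (E : ℝ) : ℝ :=
  ⨅ n : ℕ+, ((n : ℕ) : ℝ)⁻¹ *
    ∫ ω, Real.log (matNorm (cocycle (transferMat E) (n : ℕ) ω)) ∂μ

end

section MatrixNorm

attribute [local instance] Matrix.frobeniusNormedRing

lemma matNorm_eq_norm (M : Matrix (Fin 2) (Fin 2) ℝ) : matNorm M = ‖M‖ := by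
  rw [matNorm, Matrix.frobenius_norm_def, Real.sqrt_eq_rpow]
  simp

lemma matNorm_nonneg (M : Matrix (Fin 2) (Fin 2) ℝ) : 0 ≤ matNorm M := Real.sqrt_nonneg _

lemma matNorm_mul_le (M N : Matrix (Fin 2) (Fin 2) ℝ) :
    matNorm (M * N) ≤ matNorm M * matNorm N := by
  simpa only [matNorm_eq_norm] using norm_mul_le M N

lemma matNorm_add_le (M N : Matrix (Fin 2) (Fin 2) ℝ) :
    matNorm (M + N) ≤ matNorm M + matNorm N := by
  simpa only [matNorm_eq_norm] using norm_add_le M N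

end MatrixNorm

lemma sq_matNorm (M : Matrix (Fin 2) (Fin 2) ℝ) :
    matNorm M ^ 2 = M 0 0 ^ 2 + M 0 1 ^ 2 + (M 1 0 ^ 2 + M 1 1 ^ 2) := by
  rw [matNorm, Real.sq_sqrt (by positivity)]
  simp [Fin.sum_univ_two]

lemma matNorm_smul (c : ℝ) (M : Matrix (Fin 2) (Fin 2) ℝ) :
    matNorm (c • M) = |c| * matNorm M := by
  rw [← sq_eq_sq₀ (matNorm_nonneg _) (mul_nonneg (abs_nonneg _) (matNorm_nonneg _)), mul_pow,
    sq_abs, sq_matNorm, sq_matNorm]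
  simp only [Matrix.smul_apply, smul_eq_mul]
  ring

lemma matNorm_neg (M : Matrix (Fin 2) (Fin 2) ℝ) : matNorm (-M) = matNorm M := by
  simpa using matNorm_smul (-1) M

lemma abs_apply_le_matNorm (M : Matrix (Fin 2) (Fin 2) ℝ) (i j : Fin 2) :
    |M i j| ≤ matNorm M := by
  apply abs_le_of_sq_le_sq _ (matNorm_nonneg M)
  rw [sq_matNorm]
  fin_cases i <;> fin_cases j <;> simp <;> nlinarith [sq_nonneg (M 0 0), sq_nonneg (M 0 1),
    sq_nonneg (M 1 0), sq_nonneg (M 1 1)]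

lemma exists_matNorm_le_two_mul_abs (M : Matrix (Fin 2) (Fin 2) ℝ) :
    ∃ i j, matNorm M ≤ 2 * |M i j| := by
  by_contra! h
  have key : ∀ i j, 4 * M i j ^ 2 < matNorm M ^ 2 := fun i j => by
    have := h i j
    rw [← sq_abs (M i j)]
    nlinarith [abs_nonneg (M i j)]
  linarith [key 0 0, key 0 1, key 1 0, key 1 1, sq_matNorm M]

lemma one_le_matNorm {M : Matrix (Fin 2) (Fin 2) ℝ} (h : M.det = 1) : 1 ≤ matNorm M := by
  rw [← one_le_sq_iff₀ (matNorm_nonneg M), sq_matNorm]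
  rw [Matrix.det_fin_two] at h
  nlinarith [sq_nonneg (M 0 0 - M 1 1), sq_nonneg (M 0 1 + M 1 0)]

lemma matNorm_one_le : matNorm 1 ≤ 2 := by
  rw [← sq_le_sq₀ (matNorm_nonneg _) (by norm_num), sq_matNorm]
  norm_num

/-- The Euclidean norm of a column. -/
noncomputable def colNorm (M : Matrix (Fin 2) (Fin 2) ℝ) (j : Fin 2) : ℝ :=
  Real.sqrt (M 0 j ^ 2 + M 1 j ^ 2)

lemma colNorm_nonneg (M : Matrix (Fin 2) (Fin 2) ℝ) (j : Fin 2) : 0 ≤ colNorm M j :=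
  Real.sqrt_nonneg _

lemma colNorm_le_matNorm (M : Matrix (Fin 2) (Fin 2) ℝ) (j : Fin 2) :
    colNorm M j ≤ matNorm M := by
  rw [colNorm, matNorm]
  apply Real.sqrt_le_sqrt
  fin_cases j <;> simp [Fin.sum_univ_two] <;> nlinarith [sq_nonneg (M 0 0), sq_nonneg (M 0 1),
    sq_nonneg (M 1 0), sq_nonneg (M 1 1)]

lemma matNorm_transpose (M : Matrix (Fin 2) (Fin 2) ℝ) : matNorm M.transpose = matNorm M := by
  rw [← sq_eq_sq₀ (matNorm_nonneg _) (matNorm_nonneg _), sq_matNorm, sq_matNorm]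
  simp only [Matrix.transpose_apply]
  ring

lemma matNorm_mul_single_mul (X Y : Matrix (Fin 2) (Fin 2) ℝ) (j i : Fin 2) :
    matNorm (X * Matrix.single j i 1 * Y) = colNorm X j * colNorm Y.transpose i := by
  rw [← sq_eq_sq₀ (matNorm_nonneg _) (mul_nonneg (colNorm_nonneg _ _) (colNorm_nonneg _ _)),
    mul_pow, sq_matNorm, colNorm, colNorm, Real.sq_sqrt (by positivity),
    Real.sq_sqrt (by positivity)]
  fin_cases i <;> fin_cases j <;>
    simp [Matrix.mul_apply, Fin.sum_univ_two, Matrix.single_apply] <;> ring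

/-- A matrix of determinant one is, up to a bounded error, a rank one matrix. -/
lemma exists_smul_eq_mul_single_mul_add {B : Matrix (Fin 2) (Fin 2) ℝ} (hB : B.det = 1)
    (i j : Fin 2) : ∃ S : Matrix (Fin 2) (Fin 2) ℝ, matNorm S = 1 ∧
      B i j • B = B * Matrix.single j i 1 * B + S := by
  refine ⟨B i j • B - B * Matrix.single j i 1 * B, ?_, by abel⟩
  rw [Matrix.det_fin_two] at hB
  rw [← sq_eq_sq₀ (matNorm_nonneg _) zero_le_one, sq_matNorm]
  have key : (B 0 0 * B 1 1 - B 0 1 * B 1 0) ^ 2 = 1 := by rw [hB]; norm_num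
  fin_cases i <;> fin_cases j <;>
    simp [Matrix.mul_apply, Fin.sum_univ_two, Matrix.single_apply] <;> linear_combination key

/-- A lower bound for the norm of a product of three matrices in terms of the norms of the
products of consecutive factors. -/
lemma matNorm_mul_mul_ge {A B C : Matrix (Fin 2) (Fin 2) ℝ} (hB : B.det = 1)
    (h₂ : 0 ≤ matNorm (B * A) / 2 - matNorm A / matNorm B) :
    (matNorm (C * B) / 2 - matNorm C / matNorm B) * (matNorm (B * A) / 2 - matNorm A / matNorm B)
      - matNorm C * matNorm A ≤ matNorm B * matNorm (C * B * A) := by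
  obtain ⟨i, j, hij⟩ := exists_matNorm_le_two_mul_abs B
  have hb := abs_apply_le_matNorm B i j
  have hB1 := one_le_matNorm hB
  obtain ⟨S, hS, hBS⟩ := exists_smul_eq_mul_single_mul_add hB i j
  set b := |B i j|
  set x := colNorm (C * B) j
  set y := colNorm (B * A).transpose i
  have hx0 : 0 ≤ x := colNorm_nonneg _ _
  have hx : b * matNorm (C * B) ≤ x * matNorm B + matNorm C := by
    have e : B i j • (C * B) = C * B * Matrix.single j i 1 * B + C * S := by
      rw [← mul_smul_comm, hBS, mul_add]; simp only [mul_assoc]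
    rw [← matNorm_smul, e]
    refine (matNorm_add_le _ _).trans (add_le_add ?_ ?_)
    · rw [matNorm_mul_single_mul]
      exact mul_le_mul_of_nonneg_left
        ((colNorm_le_matNorm _ _).trans_eq (matNorm_transpose B)) hx0
    · simpa [hS] using matNorm_mul_le C S
  have hy : b * matNorm (B * A) ≤ y * matNorm B + matNorm A := by
    have e : B i j • (B * A) = B * Matrix.single j i 1 * (B * A) + S * A := by
      rw [← smul_mul_assoc, hBS, add_mul]; simp only [mul_assoc]
    rw [← matNorm_smul, e]
    refine (matNorm_add_le _ _).trans (add_le_add ?_ ?_)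
    · rw [matNorm_mul_single_mul, mul_comm]
      exact mul_le_mul_of_nonneg_left (colNorm_le_matNorm _ _) (colNorm_nonneg _ _)
    · simpa [hS] using matNorm_mul_le S A
  have hxy : x * y ≤ b * matNorm (C * B * A) + matNorm C * matNorm A := by
    have e : C * B * Matrix.single j i 1 * (B * A) = B i j • (C * B * A) + -(C * S * A) := by
      rw [← smul_mul_assoc, ← mul_smul_comm, hBS, mul_add, add_mul]; simp only [mul_assoc]; abel
    rw [← matNorm_mul_single_mul, e, ← matNorm_smul]
    refine (matNorm_add_le _ _).trans (add_le_add le_rfl ?_)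
    rw [matNorm_neg]
    refine (matNorm_mul_le _ _).trans (mul_le_mul_of_nonneg_right ?_ (matNorm_nonneg _))
    simpa [hS] using matNorm_mul_le C S
  have hpos : 0 < matNorm B := by linarith
  have hx' : matNorm (C * B) / 2 - matNorm C / matNorm B ≤ x := by
    rw [sub_le_iff_le_add, ← sub_le_iff_le_add', le_div_iff₀ hpos]
    nlinarith [matNorm_nonneg (C * B)]
  have hy' : matNorm (B * A) / 2 - matNorm A / matNorm B ≤ y := by
    rw [sub_le_iff_le_add, ← sub_le_iff_le_add', le_div_iff₀ hpos]
    nlinarith [matNorm_nonneg (B * A)]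
  have := mul_le_mul hx' hy' h₂ hx0
  nlinarith [mul_le_mul_of_nonneg_right hb (matNorm_nonneg (C * B * A))]

/-- Products of hyperbolic matrices without cancellation between consecutive factors grow
exponentially. -/
lemma pow_le_matNorm_of_no_cancellation {A P : ℕ → Matrix (Fin 2) (Fin 2) ℝ} (h0 : P 0 = 1)
    (hP : ∀ k, P (k + 1) = A k * P k) (hdet : ∀ k, (A k).det = 1) {L U : ℝ} (hL4 : 4 ≤ L)
    (hLU : 32 * U ≤ L ^ 2) (hL : ∀ k, L ≤ matNorm (A k)) (hU : ∀ k, matNorm (A k) ≤ U)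
    (hLL : ∀ k, L ^ 2 ≤ matNorm (A (k + 1) * A k)) (k : ℕ) :
    (L ^ 2 / (32 * U)) ^ k ≤ matNorm (P k) := by
  have hL_U : L ≤ U := (hL 0).trans (hU 0)
  have hUpos : 0 < U := by linarith
  set r := L ^ 2 / (32 * U) with hr
  have hrU : r * (32 * U) = L ^ 2 := by rw [hr]; field_simp
  have hr1 : 1 ≤ r := by rw [hr, le_div_iff₀ (by positivity)]; linarith
  have step : ∀ k, r * matNorm (P k) ≤ matNorm (P (k + 1)) := by
    intro k
    induction k with
    | zero =>
      have hrL : r * 32 ≤ L := by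
        by_contra! h
        nlinarith
      rw [hP 0, h0, mul_one]
      have := matNorm_one_le
      have := matNorm_nonneg (1 : Matrix (Fin 2) (Fin 2) ℝ)
      have := hL 0
      nlinarith
    | succ k ih =>
      have hB := hL k
      have hBU := hU k
      have hBpos : 0 < matNorm (A k) := by linarith
      have hp := matNorm_nonneg (P k)
      have hpp : matNorm (P k) ≤ matNorm (P (k + 1)) := by nlinarith
      have hq : matNorm (A (k + 1)) / matNorm (A k) ≤ L ^ 2 / 4 := by
        rw [div_le_iff₀ hBpos]
        have := hU (k + 1)
        nlinarith
      have hq' : matNorm (P k) / matNorm (A k) ≤ matNorm (P (k + 1)) / 4 := by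
        rw [div_le_iff₀ hBpos]
        nlinarith
      have h₁ : L ^ 2 / 4 ≤
          matNorm (A (k + 1) * A k) / 2 - matNorm (A (k + 1)) / matNorm (A k) := by
        linarith [hLL k]
      have h₂ : matNorm (P (k + 1)) / 4 ≤
          matNorm (A k * P k) / 2 - matNorm (P k) / matNorm (A k) := by
        rw [← hP]; linarith
      have h₁' : 0 ≤ L ^ 2 / 4 := by positivity
      have h₂' : 0 ≤ matNorm (P (k + 1)) / 4 := by linarith
      have key := matNorm_mul_mul_ge (C := A (k + 1)) (hdet k) (h₂'.trans h₂)
      have e : A (k + 1) * A k * P k = P (k + 1 + 1) := by rw [hP, hP, mul_assoc]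
      rw [e] at key
      have m1 := mul_le_mul h₁ h₂ h₂' (h₁'.trans h₁)
      have m2 : matNorm (A k) * matNorm (P (k + 1 + 1)) ≤ U * matNorm (P (k + 1 + 1)) :=
        mul_le_mul_of_nonneg_right hBU (matNorm_nonneg _)
      have m3 : matNorm (A (k + 1)) * matNorm (P k) ≤ U * matNorm (P (k + 1)) := by
        have := hU (k + 1)
        gcongr
      have m4 : r * U * matNorm (P (k + 1)) ≥ U * matNorm (P (k + 1)) := by
        have := mul_nonneg hUpos.le (hp.trans hpp)
        nlinarith
      have m5 : U * (r * matNorm (P (k + 1))) ≤ U * matNorm (P (k + 1 + 1)) := by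
        rw [← hrU] at m1
        nlinarith
      exact le_of_mul_le_mul_left m5 hUpos
  induction k with
  | zero => simpa [h0] using one_le_matNorm (M := 1) (by simp)
  | succ k ih =>
    rw [pow_succ']
    exact (mul_le_mul_of_nonneg_left ih (by linarith)).trans (step k)

section Dynamics

variable {X : Type*} {T : X → X}

/-- If `F` is a nonnegative subadditive cocycle, then `F` is controlled by the Birkhoff sums of
`F n₀` for every fixed `n₀`. -/
lemma mul_subadditive_le_birkhoffSum {s : Set X} (hT : MapsTo T s s) {F : ℕ → X → ℝ}
    (hF : ∀ m n x, F (m + n) x ≤ F m (T^[n] x) + F n x) {D : ℝ}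
    (hD : ∀ n, ∀ x ∈ s, F n x ≤ (n + 1) * D) (hD0 : 0 ≤ D) (n₀ m : ℕ) {x : X} (hx : x ∈ s) :
    n₀ * F (m + n₀) x ≤ birkhoffSum T (F n₀) m x + n₀ * (2 * n₀ + 1) * D := by
  have h1 : ∀ m, ∑ j ∈ Finset.range n₀, F (m + j) x ≤
      birkhoffSum T (F n₀) m x + n₀ ^ 2 * D := by
    intro m
    induction m with
    | zero =>
      simp only [zero_add, birkhoffSum_zero]
      calc ∑ j ∈ Finset.range n₀, F j x ≤ ∑ j ∈ Finset.range n₀, n₀ * D := by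
            refine Finset.sum_le_sum fun j hj => (hD j x hx).trans ?_
            have : (j : ℝ) + 1 ≤ n₀ := by exact_mod_cast Finset.mem_range.1 hj
            gcongr
        _ = n₀ ^ 2 * D := by simp; ring
    | succ m ih =>
      have h2 := (Finset.sum_range_succ (fun j => F (m + j) x) n₀).symm.trans
        (Finset.sum_range_succ' (fun j => F (m + j) x) n₀)
      have h3 : ∀ j, F (m + 1 + j) x = F (m + (j + 1)) x := fun j => by congr 1; omega
      have h4 := hF n₀ m x
      rw [add_comm n₀ m] at h4
      simp only [h3, birkhoffSum_succ]
      simp only [add_zero] at h2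
      linarith
  have h2 : ∀ j ∈ Finset.range n₀, F (m + n₀) x - (n₀ + 1) * D ≤ F (m + j) x := by
    intro j hj
    have hj := (Finset.mem_range.1 hj).le
    have h3 := hF (n₀ - j) (m + j) x
    rw [show n₀ - j + (m + j) = m + n₀ by omega] at h3
    have h4 := hD (n₀ - j) _ (hT.iterate (m + j) hx)
    have h5 : (((n₀ - j : ℕ) : ℝ) + 1) * D ≤ (n₀ + 1) * D := by
      have : ((n₀ - j : ℕ) : ℝ) ≤ n₀ := by exact_mod_cast Nat.sub_le _ _
      gcongr
    linarith
  have h3 := Finset.sum_le_sum h2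
  simp only [Finset.sum_const, Finset.card_range, nsmul_eq_mul] at h3
  have := h1 m
  nlinarith

variable [MeasurableSpace X]

/-- The empirical measure of an orbit segment of positive length. -/
lemma exists_probabilityMeasure_integral_eq_birkhoffAverage [TopologicalSpace X]
    [BorelSpace X] (T : X → X) {m : ℕ} (hm : m ≠ 0) (x : X) :
    ∃ ν : ProbabilityMeasure X, ∀ g : X → ℝ, Continuous g →
      ∫ y, g y ∂(ν : Measure X) = birkhoffAverage ℝ T g m x := by
  refine ⟨⟨(m : ENNReal)⁻¹ • ∑ i ∈ Finset.range m, Measure.dirac (T^[i] x), ⟨?_⟩⟩, ?_⟩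
  · simp only [Measure.smul_apply, Measure.coe_finsetSum, Finset.sum_apply, smul_eq_mul]
    simp only [measure_univ, Finset.sum_const, Finset.card_range, nsmul_eq_mul, mul_one]
    exact ENNReal.inv_mul_cancel (by exact_mod_cast hm) (ENNReal.natCast_ne_top m)
  · intro g hg
    simp only [ProbabilityMeasure.coe_mk]
    rw [integral_smul_measure, integral_finsetSum_measure]
    · simp only [integral_dirac' _ _ hg.stronglyMeasurable]
      simp [birkhoffAverage, birkhoffSum]
    · intro i _
      refine ⟨hg.aestronglyMeasurable, ?_⟩
      rw [HasFiniteIntegral, lintegral_dirac' _ (by fun_prop)]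
      exact ENNReal.coe_lt_top

/-- If Birkhoff averages of a continuous function along arbitrarily long orbit segments are at
least `a`, then there is an invariant measure with integral at least `a`. -/
lemma exists_measurePreserving_le_integral [TopologicalSpace X] [CompactSpace X] [T2Space X]
    [BorelSpace X] [HasOuterApproxClosed X] (hT : Continuous T) {f : X → ℝ} (hf : Continuous f)
    {a : ℝ} (h : ∀ N : ℕ, ∃ m ≥ N, ∃ x, m * a ≤ birkhoffSum T f m x) :
    ∃ ν : ProbabilityMeasure X, MeasurePreserving T (ν : Measure X) ν ∧
      a ≤ ∫ y, f y ∂(ν : Measure X) := by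
  choose m hm x hx using h
  have hm0 : ∀ k, m (k + 1) ≠ 0 := fun k => by have := hm (k + 1); omega
  choose ν hν using fun k =>
    exists_probabilityMeasure_integral_eq_birkhoffAverage T (hm0 k) (x (k + 1))
  obtain ⟨ν', hν'⟩ : ∃ ν', MapClusterPt ν' atTop ν := exists_clusterPt_of_compactSpace _
  obtain ⟨𝒰, h𝒰, hlim⟩ := mapClusterPt_iff_ultrafilter.1 hν'
  have hint : ∀ g : X → ℝ, Continuous g → Tendsto
      (fun k => birkhoffAverage ℝ T g (m (k + 1)) (x (k + 1))) 𝒰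
      (nhds (∫ y, g y ∂(ν' : Measure X))) := by
    intro g hg
    have := ProbabilityMeasure.tendsto_iff_forall_integral_tendsto.1 hlim
      (BoundedContinuousFunction.mkOfCompact ⟨g, hg⟩)
    refine this.congr fun k => ?_
    exact hν k g hg
  refine ⟨ν', ⟨hT.measurable, ?_⟩, ?_⟩
  · have : IsProbabilityMeasure (Measure.map T (ν' : Measure X)) :=
      Measure.isProbabilityMeasure_map hT.aemeasurable
    refine ext_of_forall_integral_eq_of_IsFiniteMeasure fun g => ?_
    rw [integral_map hT.aemeasurable g.continuous.aestronglyMeasurable]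
    refine tendsto_nhds_unique (hint _ (g.continuous.comp hT)) ?_
    have h1 := hint g g.continuous
    have h2 : Tendsto (fun k => birkhoffAverage ℝ T (g ∘ T) (m (k + 1)) (x (k + 1)) -
        birkhoffAverage ℝ T g (m (k + 1)) (x (k + 1))) atTop (nhds 0) := by
      have hlim0 : Tendsto (fun k : ℕ => 2 * ‖g‖ / ((k : ℝ) + 1)) atTop (nhds 0) :=
        tendsto_const_nhds.div_atTop
          (tendsto_atTop_add_const_right _ _ tendsto_natCast_atTop_atTop)
      refine squeeze_zero_norm (fun k => ?_) hlim0
      have hm1 : ((k : ℝ) + 1) ≤ m (k + 1) := by exact_mod_cast hm (k + 1)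
      have e : birkhoffSum T (g ∘ T) (m (k + 1)) (x (k + 1)) -
          birkhoffSum T g (m (k + 1)) (x (k + 1)) =
          g (T^[m (k + 1)] (x (k + 1))) - g (x (k + 1)) := by
        rw [← birkhoffSum_apply_sub_birkhoffSum]
        simp only [birkhoffSum, Function.comp, ← Function.iterate_succ_apply,
          ← Function.iterate_succ_apply' T]
      rw [birkhoffAverage, birkhoffAverage, ← smul_sub, e, norm_smul, norm_inv, RCLike.norm_natCast,
        inv_mul_eq_div]
      refine div_le_div₀ (by positivity) ?_ (by positivity) hm1
      refine (norm_sub_le _ _).trans ?_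
      linarith [g.norm_coe_le_norm (T^[m (k + 1)] (x (k + 1))), g.norm_coe_le_norm (x (k + 1))]
    simpa [Function.comp_def] using h1.add (h2.mono_left h𝒰)
  · refine ge_of_tendsto (hint f hf) (Eventually.of_forall fun k => ?_)
    rw [birkhoffAverage, smul_eq_mul, inv_mul_eq_div, le_div_iff₀, mul_comm]
    · exact hx (k + 1)
    · exact_mod_cast Nat.pos_of_ne_zero (hm0 k)

lemma measure_forall_iterate_notMem_eq_zero {μ : Measure X} [IsProbabilityMeasure μ]
    (hT : Ergodic T μ) {V : Set X} (hV : MeasurableSet V) (hV0 : μ V ≠ 0) :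
    μ {x | ∀ i, T^[i] x ∉ V} = 0 := by
  set Z := {x | ∀ i, T^[i] x ∉ V} with hZ
  have hmeas : MeasurableSet Z := by
    rw [hZ, Set.ofPred_forall]
    exact MeasurableSet.iInter fun i => (hT.measurable.iterate i hV).compl
  have hsub : Z ⊆ T ⁻¹' Z := fun x hx i => by simpa using hx (i + 1)
  rcases hT.ae_empty_or_univ_of_ae_le_preimage hmeas.nullMeasurableSet
    (Eventually.of_forall hsub) with h | h
  · exact ae_eq_empty.1 h
  · refine absurd ?_ hV0
    refine measure_mono_null (fun x hx => ?_) (ae_eq_univ.1 h)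
    exact fun hxZ => hxZ 0 hx

/-- The distribution of the hitting time of a set under a measure preserving map is
nonincreasing. -/
lemma mul_measure_hitting_le {μ : Measure X} [IsProbabilityMeasure μ]
    (hT : MeasurePreserving T μ μ) {V : Set X} (hV : MeasurableSet V) (m : ℕ) :
    (m + 1) * μ.real {x | T^[m] x ∈ V ∧ ∀ j < m, T^[j] x ∉ V} ≤
      μ.real {x | ∃ i ≤ m, T^[i] x ∈ V} := by
  set H : ℕ → Set X := fun i => {x | T^[i] x ∈ V ∧ ∀ j < i, T^[j] x ∉ V} with hH
  have hmeas : ∀ i, MeasurableSet (H i) := by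
    intro i
    have : H i = T^[i] ⁻¹' V ∩ ⋂ j, ⋂ _ : j < i, (T^[j] ⁻¹' V)ᶜ := by
      ext x; simp [hH]
    rw [this]
    exact (hT.measurable.iterate i hV).inter (MeasurableSet.iInter fun j =>
      MeasurableSet.iInter fun _ => (hT.measurable.iterate j hV).compl)
  have hanti : Antitone fun i => μ.real (H i) := by
    refine antitone_nat_of_succ_le fun i => ?_
    rw [← hT.measureReal_preimage (hmeas i).nullMeasurableSet]
    refine measureReal_mono fun x hx => ⟨by simpa using hx.1, fun j hj => ?_⟩
    simpa using hx.2 (j + 1) (by omega)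
  have hdisj : (↑(Finset.range (m + 1)) : Set ℕ).PairwiseDisjoint H := by
    have : ∀ i j, i < j → Disjoint (H i) (H j) := fun i j hij =>
      Set.disjoint_left.2 fun x hi hj => hj.2 i hij hi.1
    intro i _ j _ hij
    rcases lt_or_gt_of_ne hij with h | h
    · exact this i j h
    · exact (this j i h).symm
  have hsum := measureReal_biUnion_finset (μ := μ) hdisj fun i _ => hmeas i
  calc (m + 1) * μ.real (H m) = ∑ i ∈ Finset.range (m + 1), μ.real (H m) := by simp
    _ ≤ ∑ i ∈ Finset.range (m + 1), μ.real (H i) :=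
      Finset.sum_le_sum fun i hi => hanti (Nat.lt_succ_iff.1 (Finset.mem_range.1 hi))
    _ = μ.real (⋃ i ∈ Finset.range (m + 1), H i) := hsum.symm
    _ ≤ _ := by
      refine measureReal_mono fun x hx => ?_
      simp only [Set.mem_iUnion, Finset.mem_range] at hx
      obtain ⟨i, hi, hx⟩ := hx
      exact ⟨i, by omega, hx.1⟩

end Dynamics

lemma cocycle_add {𝒜 G : Type*} [Monoid G] (A : (ℤ → 𝒜) → G) (m n : ℕ) (ω : ℤ → 𝒜) :
    cocycle A (m + n) ω = cocycle A m ((shift 𝒜)^[n] ω) * cocycle A n ω := by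
  induction m with
  | zero => simp [cocycle]
  | succ m ih =>
    rw [Nat.add_right_comm, cocycle, cocycle, ih, mul_assoc, Function.iterate_add_apply]

lemma shift_iterate_apply {𝒜 : Type*} (n : ℕ) (ω : ℤ → 𝒜) (k : ℤ) :
    (shift 𝒜)^[n] ω k = ω (k + n) := by
  induction n generalizing k with
  | zero => simp
  | succ n ih =>
    rw [Function.iterate_succ_apply', shift, ih]
    congr 1
    push_cast
    ring

lemma continuous_shift {𝒜 : Type*} [TopologicalSpace 𝒜] : Continuous (shift 𝒜) :=
  continuous_pi fun n => continuous_apply (n + 1)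

lemma det_cocycle_transferMat (E : ℝ) (n : ℕ) (ω : ℤ → ℝ) :
    (cocycle (transferMat E) n ω).det = 1 := by
  induction n with
  | zero => simp [cocycle]
  | succ n ih => rw [cocycle, Matrix.det_mul, ih, transferMat, Matrix.det_fin_two_of]; norm_num

lemma cocycle_transferMat_congr (E : ℝ) (n : ℕ) {ω ρ : ℤ → ℝ}
    (h : ∀ j < n, ω (1 + j) = ρ (1 + j)) :
    cocycle (transferMat E) n ω = cocycle (transferMat E) n ρ := by
  induction n with
  | zero => rfl
  | succ n ih =>
    rw [cocycle, cocycle, ih fun j hj => h j (by exact hj.trans (by simp)), transferMat,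
      transferMat, shift_iterate_apply, shift_iterate_apply, h n (by simp)]

lemma continuous_cocycle_transferMat (n : ℕ) :
    Continuous fun p : ℝ × (ℤ → ℝ) => cocycle (transferMat p.1) n p.2 := by
  induction n with
  | zero => exact continuous_const
  | succ n ih =>
    refine Continuous.matrix_mul ?_ ih
    have : Continuous fun p : ℝ × (ℤ → ℝ) => (shift ℝ)^[n] p.2 1 := by
      simp only [shift_iterate_apply]
      exact (continuous_apply _).comp continuous_snd
    refine continuous_matrix fun i j => ?_
    fin_cases i <;> fin_cases j
    · exact continuous_fst.sub this
    · exact continuous_const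
    · exact continuous_const
    · exact continuous_const

/-- The logarithm of the norm of the transfer matrices. -/
noncomputable def logNorm (E : ℝ) (n : ℕ) (ω : ℤ → ℝ) : ℝ :=
  Real.log (matNorm (cocycle (transferMat E) n ω))

lemma one_le_matNorm_cocycle (E : ℝ) (n : ℕ) (ω : ℤ → ℝ) :
    1 ≤ matNorm (cocycle (transferMat E) n ω) := one_le_matNorm (det_cocycle_transferMat E n ω)

lemma matNorm_cocycle_pos (E : ℝ) (n : ℕ) (ω : ℤ → ℝ) :
    0 < matNorm (cocycle (transferMat E) n ω) :=
  zero_lt_one.trans_le (one_le_matNorm_cocycle E n ω)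

lemma logNorm_nonneg (E : ℝ) (n : ℕ) (ω : ℤ → ℝ) : 0 ≤ logNorm E n ω :=
  Real.log_nonneg (one_le_matNorm_cocycle E n ω)

lemma logNorm_add_le (E : ℝ) (m n : ℕ) (ω : ℤ → ℝ) :
    logNorm E (m + n) ω ≤ logNorm E m ((shift ℝ)^[n] ω) + logNorm E n ω := by
  rw [logNorm, logNorm, logNorm, ← Real.log_mul (matNorm_cocycle_pos _ _ _).ne'
    (matNorm_cocycle_pos _ _ _).ne', cocycle_add]
  refine Real.log_le_log ?_ (matNorm_mul_le _ _)
  rw [← cocycle_add]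
  exact matNorm_cocycle_pos _ _ _

lemma continuous_logNorm (n : ℕ) : Continuous fun p : ℝ × (ℤ → ℝ) => logNorm p.1 n p.2 := by
  refine Continuous.log ?_ fun p => (matNorm_cocycle_pos _ _ _).ne'
  have := continuous_cocycle_transferMat n
  unfold matNorm
  fun_prop

lemma continuous_logNorm_right (E : ℝ) (n : ℕ) : Continuous (logNorm E n) :=
  Continuous.comp (g := fun p : ℝ × (ℤ → ℝ) => logNorm p.1 n p.2) (f := fun ω => (E, ω))
    (continuous_logNorm n) (Continuous.prodMk continuous_const continuous_id)

lemma mapsTo_shift {Ω : Set (ℤ → ℝ)} (hΩ : IsSubshift Ω) : MapsTo (shift ℝ) Ω Ω :=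
  fun _ hω => hΩ.2.subset (Set.mem_image_of_mem _ hω)

lemma IsSubshift.isCompact {Ω : Set (ℤ → ℝ)} (hΩ : IsSubshift Ω) {𝒜 : Set ℝ} (h𝒜 : 𝒜.Finite)
    (hval : ∀ ω ∈ Ω, ∀ n : ℤ, ω n ∈ 𝒜) : IsCompact Ω :=
  (isCompact_univ_pi fun _ => h𝒜.isCompact).of_isClosed_subset hΩ.1
    fun ω hω n _ => hval ω hω n

lemma exists_logNorm_le {Ω : Set (ℤ → ℝ)} (hc : IsCompact Ω) (hT : MapsTo (shift ℝ) Ω Ω) (E : ℝ) :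
    ∃ D, 0 ≤ D ∧ ∀ n : ℕ, ∀ ω ∈ Ω, logNorm E n ω ≤ (n + 1) * D := by
  obtain ⟨D, hD⟩ := hc.exists_bound_of_continuousOn (continuous_logNorm_right E 1).continuousOn
  refine ⟨|D| + 1, by positivity, fun n ω hω => ?_⟩
  induction n with
  | zero =>
    have : logNorm E 0 ω ≤ 1 := by
      refine (Real.log_le_sub_one_of_pos (matNorm_cocycle_pos E 0 ω)).trans ?_
      have := matNorm_one_le
      simp only [cocycle]
      linarith
    have := abs_nonneg D
    push_cast
    linarith
  | succ n ih =>
    have h1 := logNorm_add_le E 1 n ω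
    have h2 := (le_abs_self _).trans (hD _ (hT.iterate n hω))
    have h3 := le_abs_self D
    rw [add_comm 1 n] at h1
    push_cast
    linarith

section Lyapunov

variable {Ω : Set (ℤ → ℝ)} {μ : Measure (ℤ → ℝ)}

lemma ae_mem_of_measure_compl (hconc : μ Ωᶜ = 0) : ∀ᵐ ω ∂μ, ω ∈ Ω := hconc

lemma integrable_logNorm [IsProbabilityMeasure μ] (hc : IsCompact Ω) (hconc : μ Ωᶜ = 0)
    (E : ℝ) (n : ℕ) : Integrable (logNorm E n) μ := by
  obtain ⟨D, hD⟩ := hc.exists_bound_of_continuousOn (continuous_logNorm_right E n).continuousOn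
  refine Integrable.of_bound (continuous_logNorm_right E n).aestronglyMeasurable D ?_
  filter_upwards [ae_mem_of_measure_compl hconc] with ω hω using hD ω hω

lemma lyapunov_nonneg (μ : Measure (ℤ → ℝ)) (E : ℝ) : 0 ≤ lyapunov μ E :=
  Real.iInf_nonneg fun n => mul_nonneg (by positivity)
    (integral_nonneg fun ω => logNorm_nonneg E n ω)

lemma mul_lyapunov_le (μ : Measure (ℤ → ℝ)) (E : ℝ) (n : ℕ) :
    n * lyapunov μ E ≤ ∫ ω, logNorm E n ω ∂μ := by
  rcases Nat.eq_zero_or_pos n with rfl | hn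
  · simpa using integral_nonneg fun ω => logNorm_nonneg E 0 ω
  · have h : lyapunov μ E ≤ (n : ℝ)⁻¹ * ∫ ω, logNorm E n ω ∂μ :=
      ciInf_le (f := fun k : ℕ+ => ((k : ℕ) : ℝ)⁻¹ * ∫ ω, logNorm E k ω ∂μ)
        ⟨0, by
          rintro _ ⟨k, rfl⟩
          exact mul_nonneg (by positivity) (integral_nonneg fun ω => logNorm_nonneg E k ω)⟩
        ⟨n, hn⟩
    rw [inv_mul_eq_div, le_div_iff₀ (by positivity)] at h
    linarith

lemma exists_integral_logNorm_lt {E a : ℝ} (h : lyapunov μ E < a) :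
    ∃ n : ℕ, 0 < n ∧ ∫ ω, logNorm E n ω ∂μ < n * a := by
  obtain ⟨n, hn⟩ := exists_lt_of_ciInf_lt h
  refine ⟨n, n.pos, ?_⟩
  have : (0 : ℝ) < (n : ℕ) := by exact_mod_cast n.pos
  rw [inv_mul_lt_iff₀ this] at hn
  exact hn

lemma integral_logNorm_mul_le [IsProbabilityMeasure μ] (hc : IsCompact Ω) (hconc : μ Ωᶜ = 0)
    (hinv : MeasurePreserving (shift ℝ) μ μ) (E : ℝ) (n : ℕ) {k : ℕ} (hk : 1 ≤ k) :
    ∫ ω, logNorm E (k * n) ω ∂μ ≤ k * ∫ ω, logNorm E n ω ∂μ := by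
  induction k, hk using Nat.le_induction with
  | base => simp
  | succ k hk ih =>
    have hi := hinv.iterate n
    have hcomp : ∫ ω, logNorm E (k * n) ((shift ℝ)^[n] ω) ∂μ = ∫ ω, logNorm E (k * n) ω ∂μ := by
      conv_rhs => rw [← hi.map_eq]
      rw [integral_map hi.aemeasurable (continuous_logNorm_right E _).aestronglyMeasurable]
    have hint := integrable_logNorm hc hconc E (k * n)
    calc ∫ ω, logNorm E ((k + 1) * n) ω ∂μ
        ≤ ∫ ω, (logNorm E (k * n) ((shift ℝ)^[n] ω) + logNorm E n ω) ∂μ := by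
          refine integral_mono (integrable_logNorm hc hconc E _)
            ((hi.integrable_comp_of_integrable hint).add (integrable_logNorm hc hconc E n))
            fun ω => ?_
          rw [add_mul, one_mul]
          exact logNorm_add_le E _ _ ω
      _ = ∫ ω, logNorm E (k * n) ω ∂μ + ∫ ω, logNorm E n ω ∂μ := by
          rw [← hcomp]
          exact integral_add (hi.integrable_comp_of_integrable hint)
            (integrable_logNorm hc hconc E n)
      _ ≤ _ := by push_cast; linarith

lemma le_lyapunov [IsProbabilityMeasure μ] (hc : IsCompact Ω) (hconc : μ Ωᶜ = 0)
    (hinv : MeasurePreserving (shift ℝ) μ μ) {E a : ℝ} {M : ℕ} (hM : 0 < M)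
    (h : ∀ k : ℕ, ∀ ω ∈ Ω, k * (M * a) ≤ logNorm E (k * M) ω) : a ≤ lyapunov μ E := by
  refine le_ciInf fun n => ?_
  have hn : (0 : ℝ) < (n : ℕ) := by exact_mod_cast n.pos
  have hM' : (0 : ℝ) < M := by exact_mod_cast hM
  have h1 := integral_logNorm_mul_le hc hconc hinv E (n : ℕ) hM
  have h2 : (n : ℕ) * (M * a) ≤ ∫ ω, logNorm E (M * n) ω ∂μ := by
    have : ∫ _, ((n : ℕ) : ℝ) * (M * a) ∂μ ≤ ∫ ω, logNorm E (M * n) ω ∂μ := by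
      refine integral_mono_ae (integrable_const _) (integrable_logNorm hc hconc E _) ?_
      filter_upwards [ae_mem_of_measure_compl hconc] with ω hω
      rw [mul_comm M]
      exact h n ω hω
    simpa using this
  rw [inv_mul_eq_div, le_div_iff₀ hn]
  have h3 := h2.trans h1
  refine le_of_mul_le_mul_left ?_ hM'
  calc M * (a * (n : ℕ)) = (n : ℕ) * (M * a) := by ring
    _ ≤ _ := h3

/-- The uniform upper bound for the transfer matrices in the uniquely ergodic case. -/
lemma exists_logNorm_le_of_lyapunov_lt (hc : IsCompact Ω) (hT : MapsTo (shift ℝ) Ω Ω)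
    (huniq : ∀ ν : Measure (ℤ → ℝ), IsProbabilityMeasure ν → ν Ωᶜ = 0 →
      MeasurePreserving (shift ℝ) ν ν → ν = μ) {E a : ℝ} (ha : lyapunov μ E < a) :
    ∃ B, ∀ m : ℕ, ∀ ω ∈ Ω, logNorm E m ω ≤ m * a + B := by
  obtain ⟨n₀, hn₀, hint⟩ := exists_integral_logNorm_lt ha
  obtain ⟨D, hD0, hD⟩ := exists_logNorm_le hc hT E
  have ha0 : 0 < a := (lyapunov_nonneg μ E).trans_lt ha
  have hn₀' : (0 : ℝ) < n₀ := by exact_mod_cast hn₀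
  obtain ⟨N, hN⟩ : ∃ N : ℕ, ∀ m ≥ N, ∀ ω ∈ Ω,
      birkhoffSum (shift ℝ) (logNorm E n₀) m ω < m * (n₀ * a) := by
    by_contra! hcon
    have : CompactSpace Ω := isCompact_iff_compactSpace.1 hc
    have hcont : Continuous (hT.restrict (shift ℝ) Ω Ω) := continuous_shift.restrict hT
    have hsemi : Function.Semiconj (Subtype.val : Ω → (ℤ → ℝ)) (hT.restrict (shift ℝ) Ω Ω)
      (shift ℝ) := fun _ => rfl
    obtain ⟨ν, hν, hνint⟩ := exists_measurePreserving_le_integral hcont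
      (f := fun ω : Ω => logNorm E n₀ ω)
      ((continuous_logNorm_right E n₀).comp continuous_subtype_val) (a := n₀ * a) (by
        intro N
        obtain ⟨m, hm, ω, hω, h⟩ := hcon N
        refine ⟨m, hm, ⟨ω, hω⟩, h.trans_eq ?_⟩
        refine Finset.sum_congr rfl fun k _ => ?_
        exact congrArg _ ((hsemi.iterate_right k).eq ⟨ω, hω⟩).symm)
    have hmap := huniq (Measure.map Subtype.val (ν : Measure Ω))
      (Measure.isProbabilityMeasure_map measurable_subtype_coe.aemeasurable)
      (by
        rw [Measure.map_apply measurable_subtype_coe hc.isClosed.measurableSet.compl]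
        convert measure_empty (μ := (ν : Measure Ω))
        ext x
        simp)
      (by
        refine ⟨continuous_shift.measurable, ?_⟩
        rw [Measure.map_map continuous_shift.measurable measurable_subtype_coe,
          ← hsemi.comp_eq, ← Measure.map_map measurable_subtype_coe hcont.measurable, hν.map_eq])
    rw [← hmap, integral_map measurable_subtype_coe.aemeasurable
      (continuous_logNorm_right E n₀).aestronglyMeasurable] at hint
    exact absurd hνint (not_le.2 hint)
  refine ⟨(2 * n₀ + 1) * D + (N + n₀ + 1) * D, fun m ω hω => ?_⟩
  have hpos : 0 ≤ (2 * n₀ + 1) * D := by positivity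
  have hpos' : 0 ≤ (N + n₀ + 1) * D := by positivity
  rcases le_or_gt (N + n₀) m with hm | hm
  · obtain ⟨k, rfl⟩ := Nat.exists_eq_add_of_le' (Nat.le_of_add_left_le hm)
    have h1 := mul_subadditive_le_birkhoffSum hT (logNorm_add_le E) hD hD0 n₀ k hω
    have h2 := hN k (by omega) ω hω
    have h3 : n₀ * logNorm E (k + n₀) ω ≤ n₀ * (k * a + (2 * n₀ + 1) * D) := by linarith
    have h4 := le_of_mul_le_mul_left h3 hn₀'
    push_cast
    nlinarith
  · have h1 := hD m ω hω
    have h2 : (m : ℝ) + 1 ≤ N + n₀ + 1 := by exact_mod_cast (by omega : m + 1 ≤ N + n₀ + 1)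
    have h3 : ((m : ℝ) + 1) * D ≤ (N + n₀ + 1) * D := by gcongr
    have h4 : 0 ≤ m * a := by positivity
    linarith

/-- The sequences that agree with `ρ` at the positions `1, …, m`. -/
def wordCylinder (m : ℕ) (ρ : ℤ → ℝ) : Set (ℤ → ℝ) := {ω | ∀ j < m, ω (1 + j) = ρ (1 + j)}

lemma measurableSet_wordCylinder (m : ℕ) (ρ : ℤ → ℝ) : MeasurableSet (wordCylinder m ρ) := by
  have : wordCylinder m ρ = ⋂ j, ⋂ _ : j < m, {ω : ℤ → ℝ | ω (1 + (j : ℤ)) = ρ (1 + j)} := by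
    ext ω; simp [wordCylinder]
  rw [this]
  exact MeasurableSet.iInter fun j => MeasurableSet.iInter fun _ =>
    measurableSet_eq_fun (measurable_pi_apply _) measurable_const

lemma wordOf_eq_map {α : Type*} (ρ : ℤ → α) (l : ℕ) :
    wordOf ρ l = (List.range l).map fun i : ℕ => ρ (1 + i) := by
  simp only [wordOf, List.pure_def, List.bind_eq_flatMap, List.map_flatMap, List.map_cons,
    List.map_nil, List.map_eq_flatMap (l := List.range l)]

lemma occursAt_wordOf (ρ ω : ℤ → ℝ) (l : ℕ) :
    OccursAt ω (wordOf ρ l) 1 ↔ ω ∈ wordCylinder l ρ := by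
  simp [OccursAt, wordCylinder, wordOf_eq_map, Fin.forall_iff]

/-- Under condition (B), every word of suitable length occurs near the origin with a probability
that is bounded away from zero. -/
lemma exists_le_measure_hitting_wordCylinder (hB : CondB Ω) (hT : MapsTo (shift ℝ) Ω Ω)
    (hprob : IsProbabilityMeasure μ) (hconc : μ Ωᶜ = 0)
    (huniq : ∀ ν : Measure (ℤ → ℝ), IsProbabilityMeasure ν → ν Ωᶜ = 0 →
      MeasurePreserving (shift ℝ) ν ν → ν = μ) :
    ∃ c > 0, ∀ N : ℕ, ∃ M ≥ N, ∀ m, (m = M ∨ m = 2 * M) → ∀ ρ ∈ Ω,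
      c ≤ μ.real {ω | ∃ i ≤ m, (shift ℝ)^[i] ω ∈ wordCylinder m ρ} := by
  obtain ⟨ν, hν, hνc, herg, C, hC, l, hl, hlC⟩ := hB
  obtain rfl := huniq ν hν hνc herg.toMeasurePreserving
  refine ⟨min 1 (C / 4), by positivity, fun N => ?_⟩
  obtain ⟨n, hn⟩ := (hl.eventually_ge_atTop (4 * N + 4)).exists
  have hl0 : (0 : ℝ) < l n := by exact_mod_cast (by omega : 0 < l n)
  have hcyl : ∀ ρ ∈ Ω, C ≤ l n * ν.real (Ω ∩ wordCylinder (l n) ρ) := by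
    intro ρ hρ
    have h := hlC n (wordOf ρ (l n)) ⟨ρ, hρ, 1, (occursAt_wordOf _ _ _).2 fun _ _ => rfl⟩
      (by simp [wordOf_eq_map])
    have e : Vset Ω (wordOf ρ (l n)) = Ω ∩ wordCylinder (l n) ρ := by
      ext ω
      exact and_congr_right fun _ => occursAt_wordOf _ _ _
    rw [e] at h
    simpa [wordOf_eq_map, measureReal_def] using h
  refine ⟨l n / 4, by omega, fun m hm ρ hρ => ?_⟩
  have hml : 2 * m ≤ l n := by omega
  have hlm : l n ≤ 4 * (m + 1) := by omega
  have hV := measurableSet_wordCylinder m ρ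
  have hV0 : ν (wordCylinder m ρ) ≠ 0 := by
    intro h
    have h1 : ν.real (Ω ∩ wordCylinder (l n) ρ) = 0 := by
      rw [measureReal_eq_zero_iff]
      exact measure_mono_null (show Ω ∩ wordCylinder (l n) ρ ⊆ wordCylinder m ρ from
        fun ω hω j hj => hω.2 j (by omega)) h
    have := hcyl ρ hρ
    rw [h1, mul_zero] at this
    linarith
  by_cases hex : ∃ ω ∈ Ω, (shift ℝ)^[m] ω ∈ wordCylinder m ρ ∧
      ∀ j < m, (shift ℝ)^[j] ω ∉ wordCylinder m ρ
  · obtain ⟨σ, hσ, hσm, hσj⟩ := hex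
    have hsub : Ω ∩ wordCylinder (l n) σ ⊆ {ω | (shift ℝ)^[m] ω ∈ wordCylinder m ρ ∧
        ∀ j < m, (shift ℝ)^[j] ω ∉ wordCylinder m ρ} := by
      rintro ω ⟨-, hω⟩
      have hagree : ∀ i ≤ m, ((shift ℝ)^[i] ω ∈ wordCylinder m ρ ↔ (shift ℝ)^[i] σ ∈ wordCylinder m ρ) := by
        intro i hi
        refine forall₂_congr fun j hj => ?_
        rw [shift_iterate_apply, shift_iterate_apply]
        have := hω (j + i) (by omega)
        push_cast at this
        rw [add_assoc, this]
      exact ⟨(hagree m le_rfl).2 hσm, fun j hj h => hσj j hj ((hagree j hj.le).1 h)⟩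
    have h1 := mul_measure_hitting_le herg.toMeasurePreserving hV m
    have h2 : ν.real (Ω ∩ wordCylinder (l n) σ) ≤ _ := measureReal_mono (μ := ν) hsub
    have h3 := hcyl σ hσ
    have h4 : (l n : ℝ) ≤ 4 * (m + 1) := by exact_mod_cast hlm
    have h5 : 0 ≤ ν.real (Ω ∩ wordCylinder (l n) σ) := measureReal_nonneg
    refine (min_le_right _ _).trans (le_trans ?_ h1)
    have h6 : ((m : ℝ) + 1) * ν.real (Ω ∩ wordCylinder (l n) σ) ≤ ((m : ℝ) + 1) * _ :=
      mul_le_mul_of_nonneg_left h2 (by positivity)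
    refine le_trans ?_ h6
    nlinarith
  · push Not at hex
    refine (min_le_left _ _).trans ?_
    have hnull := measure_forall_iterate_notMem_eq_zero herg hV hV0
    have hae : ∀ᵐ ω ∂ν, ω ∈ {ω | ∃ i ≤ m, (shift ℝ)^[i] ω ∈ wordCylinder m ρ} := by
      have hhit : ∀ᵐ ω ∂ν, ¬ ∀ i, (shift ℝ)^[i] ω ∉ wordCylinder m ρ :=
        measure_eq_zero_iff_ae_notMem.1 hnull
      filter_upwards [hhit, ae_mem_of_measure_compl hνc] with ω h1 h2
      by_contra h3
      simp only [not_exists, not_and] at h3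
      push Not at h1
      classical
      have hfind := Nat.find_spec h1
      have hmin : ∀ j < Nat.find h1, (shift ℝ)^[j] ω ∉ wordCylinder m ρ := fun j hj =>
        Nat.find_min h1 hj
      set t := Nat.find h1
      have ht : m < t := by
        by_contra! h
        exact h3 t h hfind
      obtain ⟨j, hj, hj'⟩ := hex ((shift ℝ)^[t - m] ω) (hT.iterate _ h2) (by
        rw [← Function.iterate_add_apply, show m + (t - m) = t by omega]
        exact hfind)
      rw [← Function.iterate_add_apply] at hj'
      exact hmin _ (by omega) hj'
    have h1 : ν.real {ω | ∃ i ≤ m, (shift ℝ)^[i] ω ∈ wordCylinder m ρ} = 1 := by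
      have h := measure_congr (eventuallyEq_univ.2 hae)
      rw [measure_univ] at h
      exact (ENNReal.toReal_eq_one_iff _).2 h
    exact h1.ge

/-- Under condition (B), the norms of the transfer matrices are uniformly bounded from below along
suitable lengths. -/
lemma exists_forall_lt_logNorm (hB : CondB Ω) (hc : IsCompact Ω) (hT : MapsTo (shift ℝ) Ω Ω)
    (hprob : IsProbabilityMeasure μ) (hconc : μ Ωᶜ = 0)
    (huniq : ∀ ν : Measure (ℤ → ℝ), IsProbabilityMeasure ν → ν Ωᶜ = 0 →
      MeasurePreserving (shift ℝ) ν ν → ν = μ) (E : ℝ) {ε : ℝ} (hε : 0 < ε) (N : ℕ) :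
    ∃ M ≥ N, ∀ m, (m = M ∨ m = 2 * M) → ∀ ρ ∈ Ω,
      m * (lyapunov μ E - ε) < logNorm E m ρ := by
  obtain ⟨c, hc0, hcyl⟩ := exists_le_measure_hitting_wordCylinder hB hT hprob hconc huniq
  set γ := lyapunov μ E
  obtain ⟨B, hBd⟩ := exists_logNorm_le_of_lyapunov_lt hc hT huniq (E := E)
    (a := γ + c * ε / 4) (by linarith [show 0 < c * ε / 4 by positivity])
  obtain ⟨N', hN'⟩ := exists_nat_gt (4 * B / (c * ε))
  obtain ⟨M, hM, hMcyl⟩ := hcyl (max N (max N' 1))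
  refine ⟨M, (le_max_left _ _).trans hM, fun m hm ρ hρ => ?_⟩
  have hmN : N' ≤ m := by
    have : N' ≤ M := (le_max_left _ _).trans ((le_max_right _ _).trans hM)
    omega
  by_contra! hcon
  have hcS := hMcyl m hm ρ hρ
  set S := {ω | ∃ i ≤ m, (shift ℝ)^[i] ω ∈ wordCylinder m ρ} with hS
  have hSmeas : MeasurableSet S := by
    have : S = ⋃ i, ⋃ _ : i ≤ m, (shift ℝ)^[i] ⁻¹' wordCylinder m ρ := by
      ext ω; simp [hS]
    rw [this]
    exact MeasurableSet.iUnion fun i => MeasurableSet.iUnion fun _ =>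
      (continuous_shift.measurable.iterate i) (measurableSet_wordCylinder m ρ)
  have hbound : ∀ ω ∈ Ω, logNorm E (2 * m) ω ≤
      (2 * m * (γ + c * ε / 4) + 2 * B) - S.indicator (fun _ => m * ε) ω := by
    intro ω hω
    have hB0 : 0 ≤ B := by simpa using (logNorm_nonneg E 0 ω).trans (hBd 0 ω hω)
    have hcε : 0 ≤ m * (c * ε / 4) := by positivity
    by_cases hωS : ω ∈ S
    · rw [indicator_of_mem hωS]
      obtain ⟨i, hi, hiω⟩ := hωS
      have h1 := logNorm_add_le E (m - i + m) i ω
      have h2 := logNorm_add_le E (m - i) m ((shift ℝ)^[i] ω)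
      rw [show m - i + m + i = 2 * m by omega] at h1
      have h3 : logNorm E m ((shift ℝ)^[i] ω) = logNorm E m ρ := by
        rw [logNorm, logNorm, cocycle_transferMat_congr E m hiω]
      have h4 := hBd i ω hω
      have h5 := hBd (m - i) _ (hT.iterate m (hT.iterate i hω))
      rw [Nat.cast_sub hi] at h5
      nlinarith
    · rw [indicator_of_notMem hωS]
      have := hBd (2 * m) ω hω
      push_cast at this
      linarith
  have hind : Integrable (S.indicator fun _ => (m : ℝ) * ε) μ :=
    (integrable_const _).indicator hSmeas
  have hint : ∫ ω, logNorm E (2 * m) ω ∂μ ≤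
      (2 * m * (γ + c * ε / 4) + 2 * B) - μ.real S * (m * ε) := by
    have h1 : ∫ ω, logNorm E (2 * m) ω ∂μ ≤
        ∫ ω, ((2 * m * (γ + c * ε / 4) + 2 * B) - S.indicator (fun _ => m * ε) ω) ∂μ := by
      refine integral_mono_ae (integrable_logNorm hc hconc E _)
        ((integrable_const _).sub hind) ?_
      filter_upwards [ae_mem_of_measure_compl hconc] with ω hω using hbound ω hω
    rwa [integral_sub (integrable_const _) hind, integral_indicator_const _ hSmeas,
      integral_const, probReal_univ, one_smul, smul_eq_mul] at h1
  have h1 := mul_lyapunov_le μ E (2 * m)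
  push_cast at h1
  have h2 : c * (m * ε) ≤ μ.real S * (m * ε) := by gcongr
  have h3 : (N' : ℝ) ≤ m := by exact_mod_cast hmN
  have h4 := hN'.trans_le h3
  rw [div_lt_iff₀ (by positivity)] at h4
  nlinarith

lemma eventually_forall_logNorm {P : ℝ → Prop} (hP : IsOpen {x | P x}) (hc : IsCompact Ω)
    {E₀ : ℝ} {n : ℕ} (h : ∀ ω ∈ Ω, P (logNorm E₀ n ω)) :
    ∀ᶠ E in nhds E₀, ∀ ω ∈ Ω, P (logNorm E n ω) :=
  hc.eventually_forall_of_forall_eventually fun ω hω =>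
    (continuous_logNorm n).continuousAt.eventually (hP.mem_nhds (h ω hω))

lemma eventually_lyapunov_lt (hc : IsCompact Ω) (hprob : IsProbabilityMeasure μ)
    (hconc : μ Ωᶜ = 0) {E₀ a : ℝ} (h : lyapunov μ E₀ < a) :
    ∀ᶠ E in nhds E₀, lyapunov μ E < a := by
  obtain ⟨n, hn, hlt⟩ := exists_integral_logNorm_lt h
  have hn' : (0 : ℝ) < n := by exact_mod_cast hn
  have hcont : ContinuousAt (fun E => ∫ ω, logNorm E n ω ∂μ) E₀ := by
    obtain ⟨D, hD⟩ := hc.exists_bound_of_continuousOn (continuous_logNorm_right E₀ n).continuousOn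
    have hev := eventually_forall_logNorm (P := fun x => |x| < D + 1)
      (isOpen_lt continuous_abs continuous_const) hc
      (fun ω hω => (hD ω hω).trans_lt (lt_add_one D))
    refine continuousAt_of_dominated
      (Eventually.of_forall fun E => (continuous_logNorm_right E n).aestronglyMeasurable)
      (bound := fun _ => D + 1) ?_ (integrable_const _) (Eventually.of_forall fun ω => ?_)
    · filter_upwards [hev] with E hE
      filter_upwards [ae_mem_of_measure_compl hconc] with ω hω using (hE ω hω).le
    · exact (Continuous.comp (g := fun p : ℝ × (ℤ → ℝ) => logNorm p.1 n p.2)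
        (f := fun E => (E, ω)) (continuous_logNorm n)
        (Continuous.prodMk continuous_id continuous_const)).continuousAt
  filter_upwards [hcont.eventually_lt continuousAt_const hlt] with E hE
  exact lt_of_mul_lt_mul_left ((mul_lyapunov_le μ E n).trans_lt hE) hn'.le

lemma eventually_le_lyapunov (hB : CondB Ω) (hc : IsCompact Ω) (hT : MapsTo (shift ℝ) Ω Ω)
    (hprob : IsProbabilityMeasure μ) (hconc : μ Ωᶜ = 0)
    (hinv : MeasurePreserving (shift ℝ) μ μ)
    (huniq : ∀ ν : Measure (ℤ → ℝ), IsProbabilityMeasure ν → ν Ωᶜ = 0 →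
      MeasurePreserving (shift ℝ) ν ν → ν = μ) {E₀ ε : ℝ} (hε : 0 < ε)
    (hγ : 4 * ε ≤ lyapunov μ E₀) :
    ∀ᶠ E in nhds E₀, lyapunov μ E₀ - 4 * ε ≤ lyapunov μ E := by
  set γ := lyapunov μ E₀
  obtain ⟨B, hBd⟩ := exists_logNorm_le_of_lyapunov_lt hc hT huniq (E := E₀)
    (a := γ + ε / 2) (by linarith)
  obtain ⟨N₁, hN₁⟩ := exists_nat_gt (B / (ε / 2))
  obtain ⟨N₂, hN₂⟩ := exists_nat_gt (Real.log 32 / ε)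
  obtain ⟨M, hM, hlow⟩ := exists_forall_lt_logNorm hB hc hT hprob hconc huniq E₀ hε
    (max (max N₁ N₂) 1)
  have hM1 : (N₁ : ℝ) ≤ M := by
    exact_mod_cast (le_max_left _ _).trans ((le_max_left _ _).trans hM)
  have hM2 : (N₂ : ℝ) ≤ M := by
    exact_mod_cast (le_max_right _ _).trans ((le_max_left _ _).trans hM)
  have hMpos : 0 < M := (le_max_right _ _).trans hM
  have hB' := hN₁.trans_le hM1
  rw [div_lt_iff₀ (by positivity)] at hB'
  have hlog := hN₂.trans_le hM2
  rw [div_lt_iff₀ hε] at hlog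
  have hev₁ := eventually_forall_logNorm (P := fun x => M * (γ - ε) < x)
    (isOpen_lt continuous_const continuous_id) hc (hlow M (Or.inl rfl))
  have hev₂ := eventually_forall_logNorm (P := fun x => ((2 * M : ℕ) : ℝ) * (γ - ε) < x)
    (isOpen_lt continuous_const continuous_id) hc (hlow (2 * M) (Or.inr rfl))
  have hev₃ := eventually_forall_logNorm (P := fun x => x < M * (γ + ε))
    (isOpen_lt continuous_id continuous_const) hc (E₀ := E₀) (n := M)
    (fun ω hω => (hBd M ω hω).trans_lt (by linarith))
  filter_upwards [hev₁, hev₂, hev₃] with E h₁ h₂ h₃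
  refine le_lyapunov hc hconc hinv hMpos fun k ω hω => ?_
  set L := Real.exp (M * (γ - ε)) with hL
  set U := Real.exp (M * (γ + ε)) with hU
  have h32 : Real.exp (Real.log 32) = 32 := Real.exp_log (by norm_num)
  have hMε : 0 < M * ε := by positivity
  have hMγ : (M : ℝ) * (4 * ε) ≤ M * γ := by gcongr
  have hL32 : 32 ≤ L := by
    rw [← h32, hL]
    exact Real.exp_le_exp.2 (by nlinarith)
  have hsq : L ^ 2 = Real.exp (2 * (M * (γ - ε))) := by
    rw [hL, ← Real.exp_nat_mul]; norm_num
  have hLU : 32 * U ≤ L ^ 2 := by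
    rw [hsq, hU, ← h32, ← Real.exp_add]
    exact Real.exp_le_exp.2 (by nlinarith)
  have key := pow_le_matNorm_of_no_cancellation
    (A := fun k => cocycle (transferMat E) M ((shift ℝ)^[k * M] ω))
    (P := fun k => cocycle (transferMat E) (k * M) ω) (by simp [cocycle])
    (fun k => by rw [add_mul, one_mul, add_comm, cocycle_add])
    (fun k => det_cocycle_transferMat _ _ _) (L := L) (U := U) (by linarith) hLU
    (fun k => ?_) (fun k => ?_) (fun k => ?_) k
  · have hr : Real.exp (M * (γ - 4 * ε)) ≤ L ^ 2 / (32 * U) := by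
      rw [le_div_iff₀ (by positivity), hsq, hU, ← h32, ← Real.exp_add, ← Real.exp_add]
      exact Real.exp_le_exp.2 (by nlinarith)
    have h5 := (pow_le_pow_left₀ (Real.exp_pos _).le hr k).trans key
    rw [← Real.exp_nat_mul] at h5
    exact (Real.le_log_iff_exp_le (matNorm_cocycle_pos _ _ _)).2 h5
  · exact ((Real.lt_log_iff_exp_lt (matNorm_cocycle_pos _ _ _)).1
      (h₁ _ (hT.iterate (k * M) hω))).le
  · exact ((Real.log_lt_iff_lt_exp (matNorm_cocycle_pos _ _ _)).1
      (h₃ _ (hT.iterate (k * M) hω))).le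
  · have h6 := h₂ _ (hT.iterate (k * M) hω)
    have e : cocycle (transferMat E) M ((shift ℝ)^[(k + 1) * M] ω) *
        cocycle (transferMat E) M ((shift ℝ)^[k * M] ω) =
        cocycle (transferMat E) (2 * M) ((shift ℝ)^[k * M] ω) := by
      rw [two_mul, cocycle_add, ← Function.iterate_add_apply, add_mul, one_mul, add_comm M]
    rw [e, hsq]
    push_cast at h6
    rw [← mul_assoc]
    exact ((Real.lt_log_iff_exp_lt (matNorm_cocycle_pos _ _ _)).1 h6).le

end Lyapunov

/-- continuity of the Lyapunov exponent for minimal subshifts over a finite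
alphabet in `ℝ` satisfying (B). -/
theorem stmt4 (Ω : Set (ℤ → ℝ)) (𝒜 : Set ℝ) (h𝒜 : 𝒜.Finite)
    (hval : ∀ ω ∈ Ω, ∀ n : ℤ, ω n ∈ 𝒜)
    (hmin : IsMinimalSubshift Ω) (hB : CondB Ω)
    (μ : Measure (ℤ → ℝ)) (hprob : IsProbabilityMeasure μ) (hconc : μ Ωᶜ = 0)
    (hinv : MeasurePreserving (shift ℝ) μ μ)
    (huniq : ∀ ν : Measure (ℤ → ℝ), IsProbabilityMeasure ν → ν Ωᶜ = 0 →
      MeasurePreserving (shift ℝ) ν ν → ν = μ) :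
    Continuous (lyapunov μ) ∧ ∀ E : ℝ, 0 ≤ lyapunov μ E := by
  have hΩ := hmin.1
  have hc := hΩ.isCompact h𝒜 hval
  have hT := mapsTo_shift hΩ
  refine ⟨continuous_iff_continuousAt.2 fun E₀ => ?_, lyapunov_nonneg μ⟩
  refine tendsto_order.2 ⟨fun a ha => ?_, fun a ha => eventually_lyapunov_lt hc hprob hconc ha⟩
  rcases lt_or_ge a 0 with h0 | h0
  · exact Eventually.of_forall fun E => h0.trans_le (lyapunov_nonneg μ E)
  · filter_upwards [eventually_le_lyapunov hB hc hT hprob hconc hinv huniq (E₀ := E₀)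
      (ε := (lyapunov μ E₀ - a) / 8) (by linarith) (by linarith)] with E hE
    linarith
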